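/- Let ṽ : ℝ³ → ℝ² and θ : ℝ³ → ℝ be smooth and 1-periodic in the horizontal variables, and suppose ∫_{−h}^0 div_H ṽ(x_H,ζ) dζ = 0 for every x_H. Set w(ṽ)(x_H,x₃) = −∫_{−h}^{x₃} div_H ṽ(x_H,ζ) dζ, ũ = (ṽ, w(ṽ)), and Θ(x_H,x₃) = ∫_{−h}^{x₃} θ(x_H,ζ) dζ. Then ∫_𝒪 Θ³ ( ∫_{−h}^{x₃} [(ũ·∇)θ](x_H,ζ) dζ ) dx = ∫_𝒪 Θ³ [ ∫_{−h}^{x₃} [(ṽ·∇_H)θ](x_H,ζ) dζ − [(ṽ·∇_H)Θ](x) + ∫_{−h}^{x₃} div_H ṽ(x_H,ζ) θ(x_H,ζ) dζ ] dx. -/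

import Mathlib

open MeasureTheory Real

noncomputable section

/-- Partial derivative of `f` in the `j`-th coordinate direction. -/
def pd (j : Fin 3) (f : (Fin 3 → ℝ) → ℝ) (x : Fin 3 → ℝ) : ℝ :=
  fderiv ℝ f x (Pi.single j 1)

/-- `f` is 1-periodic in the two horizontal variables. -/
def HorizPeriodic (f : (Fin 3 → ℝ) → ℝ) : Prop :=
  ∀ x : Fin 3 → ℝ, f (x + Pi.single 0 1) = f x ∧ f (x + Pi.single 1 1) = f x

/-- The fundamental domain `[0,1] × [0,1] × [-h,0]` of `𝒪 = 𝕋² × (-h,0)`. -/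
def Box (h : ℝ) : Set (Fin 3 → ℝ) := Set.Icc ![0, 0, -h] ![1, 1, 0]

/-- Horizontal divergence `div_H v = ∂₁ v¹ + ∂₂ v²`. -/
def divH (v : Fin 2 → (Fin 3 → ℝ) → ℝ) (x : Fin 3 → ℝ) : ℝ :=
  pd 0 (v 0) x + pd 1 (v 1) x

/-- Horizontal advection `(v · ∇_H) g = v¹ ∂₁ g + v² ∂₂ g`. -/
def advH (v : Fin 2 → (Fin 3 → ℝ) → ℝ) (g : (Fin 3 → ℝ) → ℝ) (x : Fin 3 → ℝ) : ℝ :=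
  v 0 x * pd 0 g x + v 1 x * pd 1 g x

/-- Advection `(u · ∇) g` by the full velocity field `u = (v, w)`. -/
def adv3 (v : Fin 2 → (Fin 3 → ℝ) → ℝ) (w g : (Fin 3 → ℝ) → ℝ) (x : Fin 3 → ℝ) : ℝ :=
  v 0 x * pd 0 g x + v 1 x * pd 1 g x + w x * pd 2 g x

/-- Vertical velocity `w(v)(x) = -∫_{-h}^{x₃} div_H v (x_H, ζ) dζ`. -/
def wv (h : ℝ) (v : Fin 2 → (Fin 3 → ℝ) → ℝ) (x : Fin 3 → ℝ) : ℝ :=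
  -(∫ ζ in (-h)..(x 2), divH v (Function.update x 2 ζ))

/-- Vertical primitive `Θ(x) = ∫_{-h}^{x₃} θ(x_H, ζ) dζ`. -/
def vint (h : ℝ) (θ : (Fin 3 → ℝ) → ℝ) (x : Fin 3 → ℝ) : ℝ :=
  ∫ ζ in (-h)..(x 2), θ (Function.update x 2 ζ)


open Set in
lemma aux_param (F : (Fin 3 → ℝ) → ℝ → ℝ) (hF : ContDiff ℝ 1 (fun p : (Fin 3 → ℝ) × ℝ => F p.1 p.2)) :
    ContDiff ℝ 1 (fun x => ∫ t in (0:ℝ)..1, F x t) := by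
  have hF' : Continuous (fun p : (Fin 3 → ℝ) × ℝ => fderiv ℝ (fun y => F y p.2) p.1) := by
    have h1 : ∀ p : (Fin 3 → ℝ) × ℝ, fderiv ℝ (fun y => F y p.2) p.1
        = (fderiv ℝ (fun p : (Fin 3 → ℝ) × ℝ => F p.1 p.2) p).comp
            (ContinuousLinearMap.inl ℝ (Fin 3 → ℝ) ℝ) := by
      intro p
      have h2 : HasFDerivAt (fun y : Fin 3 → ℝ => (y, p.2))
          (ContinuousLinearMap.inl ℝ (Fin 3 → ℝ) ℝ) p.1 := hasFDerivAt_prodMk_left p.1 p.2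
      have h3 : HasFDerivAt (fun p : (Fin 3 → ℝ) × ℝ => F p.1 p.2)
          (fderiv ℝ (fun p : (Fin 3 → ℝ) × ℝ => F p.1 p.2) p) (p.1, p.2) :=
        ((hF.differentiable one_ne_zero) p).hasFDerivAt
      exact (h3.comp p.1 h2).fderiv
    rw [show (fun p : (Fin 3 → ℝ) × ℝ => fderiv ℝ (fun y => F y p.2) p.1) = _ from funext h1]
    exact (hF.continuous_fderiv one_ne_zero).clm_comp continuous_const
  have key : ∀ x₀, HasFDerivAt (fun x => ∫ t in (0:ℝ)..1, F x t)
      (∫ t in (0:ℝ)..1, fderiv ℝ (fun y => F y t) x₀) x₀ := by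
    intro x₀
    obtain ⟨C, hC⟩ := ((isCompact_closedBall x₀ 1).prod (isCompact_Icc (a := (0:ℝ)) (b := 1))).exists_bound_of_continuousOn
      hF'.continuousOn
    have hc : ∀ x, Continuous (F x) := fun x =>
      hF.continuous.comp (Continuous.prodMk_right x)
    refine intervalIntegral.hasFDerivAt_integral_of_dominated_of_fderiv_le
      (F' := fun x t => fderiv ℝ (fun y => F y t) x) (bound := fun _ => C)
      (s := Metric.closedBall x₀ 1)
      (Metric.closedBall_mem_nhds x₀ one_pos) ?_ ?_ ?_ ?_ ?_ ?_
    · exact Filter.Eventually.of_forall fun x => (hc x).aestronglyMeasurable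
    · exact (hc x₀).intervalIntegrable _ _
    · exact (hF'.comp (Continuous.prodMk_right x₀)).aestronglyMeasurable
    · refine Filter.Eventually.of_forall fun t ht x hx => hC (x, t) ⟨hx, ?_⟩
      rw [uIoc_of_le zero_le_one] at ht
      exact Ioc_subset_Icc_self ht
    · exact intervalIntegrable_const
    · refine Filter.Eventually.of_forall fun t _ x _ => ?_
      have : Differentiable ℝ (fun y => F y t) :=
        (hF.differentiable one_ne_zero).comp (differentiable_id.prodMk (differentiable_const t))
      exact (this x).hasFDerivAt
  rw [contDiff_one_iff_fderiv]
  refine ⟨fun x => (key x).differentiableAt, ?_⟩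
  rw [show fderiv ℝ (fun x => ∫ t in (0:ℝ)..1, F x t) = _ from funext fun x => (key x).fderiv]
  exact intervalIntegral.continuous_parametric_intervalIntegral_of_continuous' hF' 0 1

lemma aux_vint_eq (h : ℝ) (g : (Fin 3 → ℝ) → ℝ) (x : Fin 3 → ℝ) :
    vint h g x = ∫ t in (0:ℝ)..1,
      (x 2 + h) * g (Function.update x 2 ((x 2 + h) * t + (-h))) := by
  have := intervalIntegral.smul_integral_comp_mul_add (a := 0) (b := 1)
    (fun ζ => g (Function.update x 2 ζ)) (x 2 + h) (-h)
  rw [intervalIntegral.integral_const_mul]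
  unfold vint
  rw [smul_eq_mul] at this
  rw [this]
  congr 1 <;> ring

lemma aux_upd (x : Fin 3 → ℝ) (s : ℝ) : Function.update x 2 s = ![x 0, x 1, s] := by
  ext i; fin_cases i <;> simp [Function.update]

lemma aux_vint_contDiff (h : ℝ) (g : (Fin 3 → ℝ) → ℝ) (hg : ContDiff ℝ 1 g) :
    ContDiff ℝ 1 (vint h g) := by
  rw [show vint h g = _ from funext (aux_vint_eq h g)]
  apply aux_param
  have h2 : ∀ i : Fin 3, ContDiff ℝ 1 (fun p : (Fin 3 → ℝ) × ℝ => p.1 i) := fun i =>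
    (contDiff_apply ℝ ℝ i).comp contDiff_fst
  have h3 : ContDiff ℝ 1 (fun p : (Fin 3 → ℝ) × ℝ => (p.1 2 + h) * p.2 + (-h)) :=
    (((h2 2).add contDiff_const).mul contDiff_snd).add contDiff_const
  refine ((h2 2).add contDiff_const).mul (hg.comp ?_)
  simp only [aux_upd]
  rw [contDiff_pi]
  intro i
  fin_cases i
  · exact h2 0
  · exact h2 1
  · exact h3

lemma aux_vint_cont (h : ℝ) (g : (Fin 3 → ℝ) → ℝ) (hg : Continuous g) :
    Continuous (vint h g) := by
  rw [show vint h g = _ from funext (aux_vint_eq h g)]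
  apply intervalIntegral.continuous_parametric_intervalIntegral_of_continuous'
  have h2 : ∀ i : Fin 3, Continuous (fun p : (Fin 3 → ℝ) × ℝ => p.1 i) := fun i =>
    (continuous_apply i).comp continuous_fst
  refine ((h2 2).add continuous_const).mul (hg.comp ?_)
  exact continuous_fst.update 2 (((h2 2).add continuous_const).mul continuous_snd |>.add continuous_const)

lemma aux_vint_line (h : ℝ) (g : (Fin 3 → ℝ) → ℝ) (hg : Continuous g) (x : Fin 3 → ℝ) (s : ℝ) :
    HasDerivAt (fun t => vint h g (Function.update x 2 t)) (g (Function.update x 2 s)) s := by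
  have e : (fun t => vint h g (Function.update x 2 t))
      = fun t => ∫ ζ in (-h)..t, g (Function.update x 2 ζ) := by
    funext t; simp [vint]
  rw [e]
  have hc : Continuous (fun ζ => g (Function.update x 2 ζ)) :=
    hg.comp (continuous_const.update 2 continuous_id)
  exact hc.integral_hasStrictDerivAt (-h) s |>.hasDerivAt

lemma aux_line (f : (Fin 3 → ℝ) → ℝ) (hf : Differentiable ℝ f) (x : Fin 3 → ℝ) (s : ℝ) :
    HasDerivAt (fun t => f (Function.update x 2 t)) (pd 2 f (Function.update x 2 s)) s :=
  (hf _).hasFDerivAt.comp_hasDerivAt s (hasDerivAt_update x 2 s)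

lemma aux_vint_pd (h : ℝ) (g : (Fin 3 → ℝ) → ℝ) (hg : ContDiff ℝ 1 g) (x : Fin 3 → ℝ) :
    pd 2 (vint h g) x = g x := by
  have h1 := aux_vint_line h g hg.continuous x (x 2)
  have h2 := aux_line _ ((aux_vint_contDiff h g hg).differentiable one_ne_zero) x (x 2)
  simpa using h2.unique h1

lemma aux_pd_contDiff (j : Fin 3) (f : (Fin 3 → ℝ) → ℝ) (hf : ContDiff ℝ (⊤ : ℕ∞) f) :
    ContDiff ℝ 1 (pd j f) := by
  have : ContDiff ℝ 1 (fderiv ℝ f) := hf.fderiv_right (by norm_cast)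
  exact this.clm_apply contDiff_const

lemma aux_pd_cont (j : Fin 3) (f : (Fin 3 → ℝ) → ℝ) (hf : ContDiff ℝ 1 f) :
    Continuous (pd j f) :=
  (hf.continuous_fderiv one_ne_zero).clm_apply continuous_const

lemma aux_vint_per (h : ℝ) (g : (Fin 3 → ℝ) → ℝ) (hg : HorizPeriodic g) :
    HorizPeriodic (vint h g) := by
  intro x
  constructor
  · have : ∀ ζ, Function.update (x + Pi.single 0 1) 2 ζ
        = Function.update x 2 ζ + (Pi.single 0 1 : Fin 3 → ℝ) := by
      intro ζ; ext i; fin_cases i <;> simp [Function.update]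
    simp [vint, this, (hg _).1]
  · have : ∀ ζ, Function.update (x + Pi.single 1 1) 2 ζ
        = Function.update x 2 ζ + (Pi.single 1 1 : Fin 3 → ℝ) := by
      intro ζ; ext i; fin_cases i <;> simp [Function.update]
    simp [vint, this, (hg _).2]

lemma aux_prod_pd (j : Fin 3) (G u : (Fin 3 → ℝ) → ℝ) (hG : ContDiff ℝ 1 G) (hu : ContDiff ℝ 1 u)
    (x : Fin 3 → ℝ) :
    pd j (fun y => G y ^ 4 * u y) x = 4 * G x ^ 3 * (u x * pd j G x) + G x ^ 4 * pd j u x := by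
  have h1 := ((hG.differentiable one_ne_zero) x).hasFDerivAt.pow 4
  have h2 := h1.mul ((hu.differentiable one_ne_zero) x).hasFDerivAt
  have h3 : fderiv ℝ (fun y => G y ^ 4 * u y) x = _ := h2.fderiv
  simp only [pd, h3]
  simp
  ring

lemma aux_div (h : ℝ) (hh : 0 < h) (f : Fin 3 → (Fin 3 → ℝ) → ℝ) (hf : ∀ i, ContDiff ℝ 1 (f i))
    (hp : ∀ i, HorizPeriodic (f i))
    (h0 : ∀ x : Fin 3 → ℝ, x 2 = 0 → f 2 x = 0) (h1 : ∀ x : Fin 3 → ℝ, x 2 = -h → f 2 x = 0) :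
    ∫ x in Box h, (pd 0 (f 0) x + pd 1 (f 1) x + pd 2 (f 2) x) = 0 := by
  have hle : (![0, 0, -h] : Fin 3 → ℝ) ≤ ![1, 1, 0] := by
    intro i; fin_cases i <;> simp [hh.le]
  have := integral_divergence_of_hasFDerivAt_off_countable' (n := 2) ![0, 0, -h] ![1, 1, 0] hle f
    (fun i x => fderiv ℝ (f i) x) ∅ Set.countable_empty (fun i => (hf i).continuous.continuousOn)
    (fun x _ i => ((hf i).differentiable one_ne_zero x).hasFDerivAt)
    (by
      refine ContinuousOn.integrableOn_compact isCompact_Icc (Continuous.continuousOn ?_)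
      exact continuous_finsetSum _ fun i _ => aux_pd_cont i (f i) (hf i))
  rw [Fin.sum_univ_three] at this
  have hsum : ∀ x : Fin 3 → ℝ, pd 0 (f 0) x + pd 1 (f 1) x + pd 2 (f 2) x
      = ∑ i : Fin 3, fderiv ℝ (f i) x (Pi.single i 1) := fun x =>
    (Fin.sum_univ_three (fun i : Fin 3 => fderiv ℝ (f i) x (Pi.single i 1))).symm
  simp only [hsum]
  refine Eq.trans this ?_
  have e0 : ∀ y : Fin 2 → ℝ, f 0 ((0 : Fin 3).insertNth (1:ℝ) y) = f 0 ((0 : Fin 3).insertNth (0:ℝ) y) := by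
    intro y
    rw [← ((hp 0) ((0 : Fin 3).insertNth (0:ℝ) y)).1]
    congr 1
    ext i
    refine Fin.succAboveCases (0 : Fin 3) ?_ (fun j => ?_) i
    · simp
    · simp
  have e1 : ∀ y : Fin 2 → ℝ, f 1 ((1 : Fin 3).insertNth (1:ℝ) y) = f 1 ((1 : Fin 3).insertNth (0:ℝ) y) := by
    intro y
    rw [← ((hp 1) ((1 : Fin 3).insertNth (0:ℝ) y)).2]
    congr 1
    ext i
    refine Fin.succAboveCases (1 : Fin 3) ?_ (fun j => ?_) i
    · simp
    · simp
  have e2 : ∀ y : Fin 2 → ℝ, f 2 ((2 : Fin 3).insertNth (0:ℝ) y) = 0 := fun y => h0 _ (by simp)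
  have e3 : ∀ y : Fin 2 → ℝ, f 2 ((2 : Fin 3).insertNth (-h) y) = 0 := fun y => h1 _ (by simp)
  have e0' : ∀ y : Fin 2 → ℝ, f 0 (Fin.cons (1:ℝ) y) = f 0 (Fin.cons (0:ℝ) y) := by
    intro y
    simpa only [Fin.insertNth_zero'] using e0 y
  simp [e0', e1, e2, e3]

/-- cancellation used in the estimate for `‖Θ‖·‖∇_H Θ‖`. -/
theorem statement8
    (h : ℝ) (hh : 0 < h)
    (vt : Fin 2 → (Fin 3 → ℝ) → ℝ)
    (hvt_smooth : ∀ i, ContDiff ℝ (⊤ : ℕ∞) (vt i))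
    (hvt_per : ∀ i, HorizPeriodic (vt i))
    (θ : (Fin 3 → ℝ) → ℝ)
    (hθ_smooth : ContDiff ℝ (⊤ : ℕ∞) θ) (hθ_per : HorizPeriodic θ)
    (hdiv : ∀ x : Fin 3 → ℝ, (∫ ζ in (-h)..(0:ℝ), divH vt (Function.update x 2 ζ)) = 0) :
    (∫ x in Box h,
        (vint h θ x) ^ 3
          * (∫ ζ in (-h)..(x 2), adv3 vt (wv h vt) θ (Function.update x 2 ζ)))
      = ∫ x in Box h,
          (vint h θ x) ^ 3
            * ((∫ ζ in (-h)..(x 2), advH vt θ (Function.update x 2 ζ))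
                - advH vt (vint h θ) x
                + (∫ ζ in (-h)..(x 2),
                    divH vt (Function.update x 2 ζ) * θ (Function.update x 2 ζ))) := by
  have hv1 : ∀ i, ContDiff ℝ 1 (vt i) := fun i => (hvt_smooth i).of_le (by norm_cast)
  have hθ1 : ContDiff ℝ 1 θ := hθ_smooth.of_le (by norm_cast)
  have hd : ContDiff ℝ 1 (divH vt) :=
    (aux_pd_contDiff 0 _ (hvt_smooth 0)).add (aux_pd_contDiff 1 _ (hvt_smooth 1))
  have hw_eq : wv h vt = fun x => -(vint h (divH vt) x) := rfl
  have hw : ContDiff ℝ 1 (wv h vt) := by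
    rw [hw_eq]; exact (aux_vint_contDiff h _ hd).neg
  have hG := aux_vint_contDiff h θ hθ1
  have hwpd : ∀ x, pd 2 (wv h vt) x = - divH vt x := by
    intro x
    rw [← aux_vint_pd h _ hd x, hw_eq]
    unfold pd
    rw [fderiv_fun_neg]; rfl
  have hpdper : ∀ (j : Fin 3) (f : (Fin 3 → ℝ) → ℝ), HorizPeriodic f → HorizPeriodic (pd j f) := by
    intro j f hf x
    unfold pd
    constructor
    · rw [← fderiv_comp_add_right]
      simp only [fun y => (hf y).1]
    · rw [← fderiv_comp_add_right]
      simp only [fun y => (hf y).2]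
  have hdper : HorizPeriodic (divH vt) := fun x => by
    unfold divH
    simp only [(hpdper 0 _ (hvt_per 0) x).1, (hpdper 0 _ (hvt_per 0) x).2,
      (hpdper 1 _ (hvt_per 1) x).1, (hpdper 1 _ (hvt_per 1) x).2, and_self]
  have hwper : HorizPeriodic (wv h vt) := fun x => by
    rw [hw_eq]
    simp only [(aux_vint_per h _ hdper x).1, (aux_vint_per h _ hdper x).2, and_self]
  have hGper := aux_vint_per h θ hθ_per
  set u : Fin 3 → (Fin 3 → ℝ) → ℝ := ![vt 0, vt 1, wv h vt] with hu
  have huC : ∀ i, ContDiff ℝ 1 (u i) := by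
    intro i; fin_cases i
    · exact hv1 0
    · exact hv1 1
    · exact hw
  have huP : ∀ i, HorizPeriodic (u i) := by
    intro i; fin_cases i
    · exact hvt_per 0
    · exact hvt_per 1
    · exact hwper
  have hdivint := aux_div h hh (fun i y => vint h θ y ^ 4 * u i y)
    (fun i => (hG.pow 4).mul (huC i))
    (fun i x => by simp only [(hGper x).1, (hGper x).2, (huP i x).1, (huP i x).2, and_self])
    (fun x hx => by
      have : wv h vt x = 0 := by
        unfold wv; rw [hx, hdiv]; simp
      simp [hu, this])
    (fun x hx => by
      have : wv h vt x = 0 := by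
        unfold wv; rw [hx]; simp
      simp [hu, this])
  have hD : ∀ x, pd 0 (fun y => vint h θ y ^ 4 * u 0 y) x + pd 1 (fun y => vint h θ y ^ 4 * u 1 y) x
      + pd 2 (fun y => vint h θ y ^ 4 * u 2 y) x
      = 4 * (vint h θ x ^ 3 * (advH vt (vint h θ) x + wv h vt x * θ x)) := by
    intro x
    rw [aux_prod_pd _ _ _ hG (huC 0), aux_prod_pd _ _ _ hG (huC 1), aux_prod_pd _ _ _ hG (huC 2)]
    have e2 : u 2 = wv h vt := rfl
    have e1 : u 1 = vt 1 := rfl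
    have e0 : u 0 = vt 0 := rfl
    rw [e2, e1, e0, hwpd, aux_vint_pd h θ hθ1]
    unfold advH divH
    ring
  simp only [hD] at hdivint
  rw [integral_const_mul] at hdivint
  have hzero : ∫ x in Box h, vint h θ x ^ 3 * (advH vt (vint h θ) x + wv h vt x * θ x) = 0 := by
    linarith
  have hadvc : ∀ g, ContDiff ℝ 1 g → Continuous (advH vt g) := fun g hg =>
    ((hv1 0).continuous.mul (aux_pd_cont 0 g hg)).add ((hv1 1).continuous.mul (aux_pd_cont 1 g hg))
  have hdθ : Continuous (fun x => divH vt x * θ x) := hd.continuous.mul hθ1.continuous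
  have hpt : ∀ x, (∫ ζ in (-h)..(x 2), adv3 vt (wv h vt) θ (Function.update x 2 ζ))
      = (∫ ζ in (-h)..(x 2), advH vt θ (Function.update x 2 ζ)) + wv h vt x * θ x
        + ∫ ζ in (-h)..(x 2), divH vt (Function.update x 2 ζ) * θ (Function.update x 2 ζ) := by
    intro x
    have hup : Continuous (fun ζ : ℝ => Function.update x 2 ζ) := continuous_const.update 2 continuous_id
    have hpc : Continuous (fun ζ => pd 2 θ (Function.update x 2 ζ)) := (aux_pd_cont 2 θ hθ1).comp hup
    have ibp := intervalIntegral.integral_mul_deriv_eq_deriv_mul (a := -h) (b := x 2)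
      (u := fun ζ => wv h vt (Function.update x 2 ζ)) (v := fun ζ => θ (Function.update x 2 ζ))
      (u' := fun ζ => - divH vt (Function.update x 2 ζ)) (v' := fun ζ => pd 2 θ (Function.update x 2 ζ))
      (fun s _ => (aux_vint_line h _ hd.continuous x s).neg)
      (fun s _ => aux_line θ (hθ1.differentiable one_ne_zero) x s)
      ((hd.continuous.comp hup).neg.intervalIntegrable _ _)
      (hpc.intervalIntegrable _ _)
    have hw0 : wv h vt (Function.update x 2 (-h)) = 0 := by simp [wv]
    simp only [hw0, Function.update_eq_self, neg_mul, intervalIntegral.integral_neg] at ibp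
    have hsplit : (∫ ζ in (-h)..(x 2), adv3 vt (wv h vt) θ (Function.update x 2 ζ))
        = (∫ ζ in (-h)..(x 2), advH vt θ (Function.update x 2 ζ))
          + ∫ ζ in (-h)..(x 2), wv h vt (Function.update x 2 ζ) * pd 2 θ (Function.update x 2 ζ) := by
      rw [← intervalIntegral.integral_add]
      · rfl
      · exact ((hadvc θ hθ1).comp hup).intervalIntegrable _ _
      · exact ((hw.continuous.comp hup).mul hpc).intervalIntegrable _ _
    rw [hsplit, ibp]
    ring
  have hB : IsCompact (Box h) := isCompact_Icc
  have i1 : IntegrableOn (fun x => vint h θ x ^ 3 * (advH vt (vint h θ) x + wv h vt x * θ x)) (Box h) :=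
    ContinuousOn.integrableOn_compact hB (Continuous.continuousOn
      ((hG.continuous.pow 3).mul ((hadvc _ hG).add (hw.continuous.mul hθ1.continuous))))
  have i2 : IntegrableOn (fun x => (vint h θ x) ^ 3
            * ((∫ ζ in (-h)..(x 2), advH vt θ (Function.update x 2 ζ))
                - advH vt (vint h θ) x
                + (∫ ζ in (-h)..(x 2),
                    divH vt (Function.update x 2 ζ) * θ (Function.update x 2 ζ)))) (Box h) :=
    ContinuousOn.integrableOn_compact hB (Continuous.continuousOn
      ((hG.continuous.pow 3).mul (((aux_vint_cont h _ (hadvc θ hθ1)).sub (hadvc _ hG)).add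
        (aux_vint_cont h _ hdθ))))
  rw [← add_zero (∫ x in Box h, (vint h θ x) ^ 3
            * ((∫ ζ in (-h)..(x 2), advH vt θ (Function.update x 2 ζ))
                - advH vt (vint h θ) x
                + (∫ ζ in (-h)..(x 2),
                    divH vt (Function.update x 2 ζ) * θ (Function.update x 2 ζ)))),
    ← hzero, ← integral_add i2 i1]
  congr 1
  funext x
  rw [hpt x]
  ring
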